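/- arXiv:2212.07808 — 4 statements merged into one kernel-verified Lean document; each statement's English description precedes it below -/
import Mathlib

section
/- Let C = (C_1,…,C_d) be a row contraction on a Hilbert space H_C, A = (A_1,…,A_d) a row contraction on a Hilbert space H_A, and δ : 𝒟_{*,A} → 𝒟_C a contraction. Define B := D_{*,A} ∘ δ* ∘ D_C : H_C^d → H_A, and let E be the tuple on H_C ⊕ H_A with block matrices E_i = [[C_i, 0],[B_i, A_i]], where B_i := B ∘ ι_i with ι_i : H_C → H_C^d the i-th coordinate inclusion. Then there exists a unitary operator σ'_E : 𝒟_{*,E} → 𝒟_{*,C} ⊕ 𝒟_δ such that for every h_C ⊕ h_A ∈ H_C ⊕ H_A, σ'_E (D_{*,E}(h_C ⊕ h_A)) = (D_{*,C} h_C − 𝐂 δ D_{*,A} h_A) ⊕ (D_δ D_{*,A} h_A), where 𝐂 : H_C^d → H_C is the row operator of C. -/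
noncomputable section

/-- The Hilbert space `ℓ²`-direct sum of `d` copies of `H`. -/
abbrev Hd (d : ℕ) (H : Type*) : Type _ := PiLp 2 fun _ : Fin d => H

/-- The row operator `𝐀 : H^d → K`, `(h_1, …, h_d) ↦ Σ_i A_i h_i`, of a `d`-tuple of
bounded operators `A_i : H → K`. -/
noncomputable def rowOp {d : ℕ} {H K : Type*} [NormedAddCommGroup H] [InnerProductSpace ℂ H]
    [NormedAddCommGroup K] [InnerProductSpace ℂ K] (A : Fin d → (H →L[ℂ] K)) :
    Hd d H →L[ℂ] K :=
  ∑ i, (A i).comp ((ContinuousLinearMap.proj i).comp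
    (PiLp.continuousLinearEquiv 2 ℂ fun _ : Fin d => H).toContinuousLinearMap)

/-- The `i`-th coordinate inclusion `ι_i : H → H^d`. -/
noncomputable def inclPi {d : ℕ} {H : Type*} [NormedAddCommGroup H] [InnerProductSpace ℂ H]
    (i : Fin d) : H →L[ℂ] Hd d H :=
  ((PiLp.continuousLinearEquiv 2 ℂ fun _ : Fin d => H).symm.toContinuousLinearMap).comp
    (ContinuousLinearMap.pi fun j => if j = i then ContinuousLinearMap.id ℂ H else 0)

/-- First coordinate projection of the Hilbert direct sum `H ⊕ K`. -/
noncomputable def prodFst {H K : Type*} [NormedAddCommGroup H] [InnerProductSpace ℂ H]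
    [NormedAddCommGroup K] [InnerProductSpace ℂ K] : WithLp 2 (H × K) →L[ℂ] H :=
  (ContinuousLinearMap.fst ℂ H K).comp (WithLp.prodContinuousLinearEquiv 2 ℂ H K).toContinuousLinearMap

/-- Second coordinate projection of the Hilbert direct sum `H ⊕ K`. -/
noncomputable def prodSnd {H K : Type*} [NormedAddCommGroup H] [InnerProductSpace ℂ H]
    [NormedAddCommGroup K] [InnerProductSpace ℂ K] : WithLp 2 (H × K) →L[ℂ] K :=
  (ContinuousLinearMap.snd ℂ H K).comp (WithLp.prodContinuousLinearEquiv 2 ℂ H K).toContinuousLinearMap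

/-- The `2 × 2` block operator `[[T₁₁, T₁₂], [T₂₁, T₂₂]] : H ⊕ K → H' ⊕ K'`. -/
noncomputable def block2 {H K H' K' : Type*}
    [NormedAddCommGroup H] [InnerProductSpace ℂ H] [NormedAddCommGroup K] [InnerProductSpace ℂ K]
    [NormedAddCommGroup H'] [InnerProductSpace ℂ H'] [NormedAddCommGroup K'] [InnerProductSpace ℂ K']
    (T11 : H →L[ℂ] H') (T12 : K →L[ℂ] H') (T21 : H →L[ℂ] K') (T22 : K →L[ℂ] K') :
    WithLp 2 (H × K) →L[ℂ] WithLp 2 (H' × K') :=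
  ((WithLp.prodContinuousLinearEquiv 2 ℂ H' K').symm.toContinuousLinearMap).comp
    ((T11.comp prodFst + T12.comp prodSnd).prod (T21.comp prodFst + T22.comp prodSnd))

/-- The defect space of a defect operator `D : H → K`: the closure of its range. -/
abbrev defectSpace {H K : Type*} [NormedAddCommGroup H] [InnerProductSpace ℂ H]
    [NormedAddCommGroup K] [InnerProductSpace ℂ K] (D : H →L[ℂ] K) : Submodule ℂ K :=
  (LinearMap.range (D : H →ₗ[ℂ] K)).topologicalClosure

/-- A defect operator `D : H → K`, viewed as a map into its defect space. -/
noncomputable def toDefect {H K : Type*} [NormedAddCommGroup H] [InnerProductSpace ℂ H]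
    [NormedAddCommGroup K] [InnerProductSpace ℂ K] (D : H →L[ℂ] K) : H →L[ℂ] ↥(defectSpace D) :=
  D.codRestrict _ fun x => Submodule.le_topologicalClosure _ (LinearMap.mem_range_self _ x)

/-- The canonical identification `(H ⊕ K)^d ≅ H^d ⊕ K^d`:  from a pair
`(h, k) ∈ H^d ⊕ K^d` form the element of `(H ⊕ K)^d` with `i`-th entry `(h_i, k_i)`. -/
noncomputable def pairup {d : ℕ} {H K : Type*} [NormedAddCommGroup H] [InnerProductSpace ℂ H]
    [NormedAddCommGroup K] [InnerProductSpace ℂ K] (h : Hd d H) (k : Hd d K) :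
    Hd d (WithLp 2 (H × K)) :=
  (WithLp.equiv 2 _).symm fun i =>
    (WithLp.equiv 2 (H × K)).symm ((WithLp.equiv 2 _) h i, (WithLp.equiv 2 _) k i)


/-- A finite `ℓ²`-direct sum of complete spaces is complete. -/
instance PiLp.instCompleteSpaceOfFintype (p : ENNReal) [Fact (1 ≤ p)] {ι : Type*} [Fintype ι]
    (β : ι → Type*) [∀ i, NormedAddCommGroup (β i)] [∀ i, CompleteSpace (β i)] :
    CompleteSpace (PiLp p β) := by
  have e : PiLp p β ≃ᵤ (∀ i, β i) :=
    { toEquiv := WithLp.equiv p _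
      uniformContinuous_toFun := (PiLp.lipschitzWith_ofLp p β).uniformContinuous
      uniformContinuous_invFun := ((PiLp.antilipschitzWith_ofLp p β).to_rightInverse
        (fun _ => rfl)).uniformContinuous }
  exact e.completeSpace_iff.mpr inferInstance


section Helpers

open ContinuousLinearMap

theorem aux_defect_norm {H K : Type*} [NormedAddCommGroup H] [InnerProductSpace ℂ H]
    [CompleteSpace H] [NormedAddCommGroup K] [InnerProductSpace ℂ K] [CompleteSpace K]
    (D : H →L[ℂ] H) (hD : D.IsPositive) (T : H →L[ℂ] K)
    (h : D.comp D = 1 - (adjoint T).comp T) (x : H) : ‖D x‖ ^ 2 = ‖x‖ ^ 2 - ‖T x‖ ^ 2 := by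
  have h1 : inner ℂ (D x) (D x) = inner ℂ x x - inner ℂ (T x) (T x) := by
    rw [hD.inner_left_eq_inner_right]
    have : D (D x) = x - adjoint T (T x) := by
      simpa using congrArg (fun S : H →L[ℂ] H => S x) h
    rw [this, inner_sub_right, adjoint_inner_right]
  have h2 := congrArg Complex.re h1
  simpa [inner_self_eq_norm_sq_to_K, ← Complex.ofReal_pow] using h2

theorem block2_apply {H K H' K' : Type*}
    [NormedAddCommGroup H] [InnerProductSpace ℂ H] [NormedAddCommGroup K] [InnerProductSpace ℂ K]
    [NormedAddCommGroup H'] [InnerProductSpace ℂ H'] [NormedAddCommGroup K'] [InnerProductSpace ℂ K']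
    (T11 : H →L[ℂ] H') (T12 : K →L[ℂ] H') (T21 : H →L[ℂ] K') (T22 : K →L[ℂ] K')
    (v : WithLp 2 (H × K)) :
    block2 T11 T12 T21 T22 v =
      WithLp.toLp 2 (T11 v.fst + T12 v.snd, T21 v.fst + T22 v.snd) := rfl

theorem aux_intertwine {H K : Type*} [NormedAddCommGroup H] [InnerProductSpace ℂ H]
    [CompleteSpace H] [NormedAddCommGroup K] [InnerProductSpace ℂ K] [CompleteSpace K]
    (T : H →L[ℂ] K) (D : H →L[ℂ] H) (hD : D.IsPositive)
    (h : D.comp D = 1 - (adjoint T).comp T)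
    (D' : K →L[ℂ] K) (hD' : D'.IsPositive)
    (h' : D'.comp D' = 1 - T.comp (adjoint T)) (x : H) : T (D x) = D' (T x) := by
  have e1 : ∀ x, D (D x) = x - adjoint T (T x) := fun x => by
    simpa using congrArg (fun S : H →L[ℂ] H => S x) h
  have e2 : ∀ x, D' (D' x) = x - T (adjoint T x) := fun x => by
    simpa using congrArg (fun S : K →L[ℂ] K => S x) h'
  let M : WithLp 2 (H × K) →L[ℂ] WithLp 2 (H × K) := block2 0 (adjoint T) T 0
  let P : WithLp 2 (H × K) →L[ℂ] WithLp 2 (H × K) := block2 D 0 0 D'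
  have hP : 0 ≤ P := by
    rw [nonneg_iff_isPositive]
    refine ⟨fun x y => ?_, fun x => ?_⟩
    · simp [P, block2_apply, WithLp.prod_inner_apply, hD.inner_left_eq_inner_right,
        hD'.inner_left_eq_inner_right]
    · have a := hD.re_inner_nonneg_left x.fst
      have b := hD'.re_inner_nonneg_left x.snd
      simp only [reApplyInnerSelf, P, block2_apply, WithLp.prod_inner_apply] at *
      simp at *
      linarith
  have hc : Commute (P * P) M := by
    ext v <;> simp [P, M, block2_apply, e1, e2]
  have hc' : Commute (CFC.sqrt (P * P)) M := by
    rw [CFC.sqrt_eq_cfc]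
    exact hc.cfc_nnreal _
  rw [CFC.sqrt_mul_self P hP] at hc'
  have := congrArg (fun S : WithLp 2 (H × K) →L[ℂ] WithLp 2 (H × K) =>
    (S (WithLp.toLp 2 (x, 0))).snd) hc'.eq
  simpa [P, M, block2_apply] using this.symm

theorem rowOp_apply {d : ℕ} {H K : Type*} [NormedAddCommGroup H] [InnerProductSpace ℂ H]
    [NormedAddCommGroup K] [InnerProductSpace ℂ K] (A : Fin d → (H →L[ℂ] K)) (v : Hd d H) :
    rowOp A v = ∑ i, A i (v i) := by
  simp [rowOp]

theorem aux_incl {d : ℕ} {H K : Type*} [NormedAddCommGroup H] [InnerProductSpace ℂ H]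
    [NormedAddCommGroup K] [InnerProductSpace ℂ K] (B : Hd d H →L[ℂ] K) (v : Hd d H) :
    ∑ i, B (inclPi i (v i)) = B v := by
  rw [← map_sum]
  congr 1
  ext j
  simp only [inclPi, WithLp.ofLp_sum, Finset.sum_apply]
  rw [Finset.sum_eq_single j]
  · simp
  · intro i _ hij
    simp [hij.symm]
  · simp

theorem aux_adjoint {d : ℕ} {H K : Type*}
    [NormedAddCommGroup H] [InnerProductSpace ℂ H] [CompleteSpace H]
    [NormedAddCommGroup K] [InnerProductSpace ℂ K] [CompleteSpace K]
    (C : Fin d → (H →L[ℂ] H)) (A : Fin d → (K →L[ℂ] K)) (B : Hd d H →L[ℂ] K)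
    (E : Fin d → (WithLp 2 (H × K) →L[ℂ] WithLp 2 (H × K)))
    (hE : ∀ i, E i = block2 (C i) 0 (B.comp (inclPi i)) (A i)) (h : WithLp 2 (H × K)) :
    ‖adjoint (rowOp E) h‖ ^ 2 =
      ‖adjoint (rowOp C) h.fst + adjoint B h.snd‖ ^ 2 + ‖adjoint (rowOp A) h.snd‖ ^ 2 := by
  have key : adjoint (rowOp E) h =
      pairup (adjoint (rowOp C) h.fst + adjoint B h.snd) (adjoint (rowOp A) h.snd) := by
    refine ext_inner_left ℂ fun v => ?_
    let v1 : Hd d H := WithLp.toLp 2 fun i => (v i).fst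
    let v2 : Hd d K := WithLp.toLp 2 fun i => (v i).snd
    have f1 : rowOp E v = WithLp.toLp 2 (rowOp C v1, B v1 + rowOp A v2) := by
      rw [← aux_incl B v1]
      apply WithLp.ofLp_injective 2
      refine Prod.ext ?_ ?_
      · simp [rowOp_apply, hE, block2_apply, v1, WithLp.ofLp_sum, Prod.fst_sum]
      · simp [rowOp_apply, hE, block2_apply, v1, v2, WithLp.ofLp_sum, Prod.snd_sum,
          Finset.sum_add_distrib]
    have f2 : ∀ a b, inner ℂ v (pairup a b) = inner ℂ v1 a + inner ℂ v2 b := by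
      intro a b
      simp [PiLp.inner_apply, WithLp.prod_inner_apply, pairup, v1, v2, Finset.sum_add_distrib]
    rw [adjoint_inner_right, f1, f2, inner_add_right, adjoint_inner_right, adjoint_inner_right,
      adjoint_inner_right, WithLp.prod_inner_apply]
    simp only [inner_add_left]
    rw [add_assoc]
    rfl
  rw [key]
  simp [PiLp.norm_sq_eq_of_L2, WithLp.prod_norm_sq_eq_of_L2, pairup, Finset.sum_add_distrib]

theorem toDefect_coe {H K : Type*} [NormedAddCommGroup H] [InnerProductSpace ℂ H]
    [NormedAddCommGroup K] [InnerProductSpace ℂ K] (D : H →L[ℂ] K) (x : H) :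
    ((toDefect D x : defectSpace D) : K) = D x := rfl

theorem toDefect_dense {H K : Type*} [NormedAddCommGroup H] [InnerProductSpace ℂ H]
    [NormedAddCommGroup K] [InnerProductSpace ℂ K] (D : H →L[ℂ] K) :
    DenseRange (toDefect D) := by
  intro y
  rw [closure_subtype]
  have := y.2
  rw [← SetLike.mem_coe, Submodule.topologicalClosure_coe] at this
  convert! this using 2
  ext z
  constructor
  · rintro ⟨_, ⟨x, rfl⟩, rfl⟩
    exact ⟨x, rfl⟩
  · rintro ⟨x, rfl⟩
    exact ⟨_, ⟨x, rfl⟩, rfl⟩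

/-- membership in the defect space is preserved -/
theorem aux_mem {H K : Type*} [NormedAddCommGroup H] [InnerProductSpace ℂ H]
    [CompleteSpace H] [NormedAddCommGroup K] [InnerProductSpace ℂ K] [CompleteSpace K]
    (T : H →L[ℂ] K) (D : H →L[ℂ] H) (D' : K →L[ℂ] K) (h : ∀ x, T (D x) = D' (T x))
    (y : defectSpace D) : T y ∈ defectSpace D' := by
  refine (toDefect_dense D).induction_on (p := fun y => T y ∈ defectSpace D') y ?_ ?_
  · exact (Submodule.isClosed_topologicalClosure _).preimage
      (T.continuous.comp continuous_subtype_val)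
  · intro x
    rw [toDefect_coe, h]
    exact (toDefect D' (T x)).2

/-- a vector of the defect space orthogonal to the range vanishes -/
theorem aux_orth {H K : Type*} [NormedAddCommGroup H] [InnerProductSpace ℂ H]
    [NormedAddCommGroup K] [InnerProductSpace ℂ K] (D : H →L[ℂ] K) (y : defectSpace D)
    (h : ∀ x, inner ℂ (y : K) (D x) = 0) : y = 0 := by
  have : ∀ z : defectSpace D, inner ℂ y z = 0 := fun z => by
    refine (toDefect_dense D).induction_on (p := fun z => inner ℂ y z = 0) z ?_ ?_
    · exact isClosed_eq (by fun_prop) continuous_const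
    · exact h
  exact inner_self_eq_zero.1 (this y)

theorem aux_ext {V W U : Type*} [NormedAddCommGroup V] [InnerProductSpace ℂ V]
    [NormedAddCommGroup W] [InnerProductSpace ℂ W] [CompleteSpace W]
    [NormedAddCommGroup U] [InnerProductSpace ℂ U] [CompleteSpace U]
    (S : V →L[ℂ] W) (T : V →L[ℂ] U) (hS : DenseRange S) (hT : DenseRange T)
    (h : ∀ v, ‖T v‖ = ‖S v‖) : ∃ σ : W ≃ₗᵢ[ℂ] U, ∀ v, σ (S v) = T v :=
  ⟨(LinearEquiv.refl ℂ V).extendOfIsometry S.toLinearMap T.toLinearMap hS hT h, fun v =>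
    LinearEquiv.extendOfIsometry_eq (LinearEquiv.refl ℂ V) S.toLinearMap T.toLinearMap hS hT h v⟩

theorem aux_dense {V U : Type*} [NormedAddCommGroup V] [InnerProductSpace ℂ V]
    [NormedAddCommGroup U] [InnerProductSpace ℂ U] [CompleteSpace U]
    (T : V →L[ℂ] U) (h : ∀ w, (∀ v, inner ℂ w (T v) = 0) → w = 0) : DenseRange T := by
  have : (LinearMap.range T.toLinearMap).topologicalClosure = ⊤ := by
    rw [Submodule.topologicalClosure_eq_top_iff, Submodule.eq_bot_iff]
    intro w hw
    rw [Submodule.mem_orthogonal'] at hw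
    exact h w fun v => hw _ ⟨v, rfl⟩
  have h2 := Submodule.dense_iff_topologicalClosure_eq_top.2 this
  rwa [LinearMap.coe_range] at h2

end Helpers

set_option maxHeartbeats 1600000 in
open ContinuousLinearMap in
/-- There is a unitary `σ'_E : 𝒟_{*,E} → 𝒟_{*,C} ⊕ 𝒟_δ` with
`σ'_E (D_{*,E}(h_C ⊕ h_A)) = (D_{*,C} h_C − 𝐂 δ D_{*,A} h_A) ⊕ (D_δ D_{*,A} h_A)`. -/
theorem statement3 {d : ℕ} {H_C H_A : Type*}
    [NormedAddCommGroup H_C] [InnerProductSpace ℂ H_C] [CompleteSpace H_C]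
    [NormedAddCommGroup H_A] [InnerProductSpace ℂ H_A] [CompleteSpace H_A]
    (C : Fin d → (H_C →L[ℂ] H_C)) (A : Fin d → (H_A →L[ℂ] H_A))
    (hC : ‖rowOp C‖ ≤ 1) (hA : ‖rowOp A‖ ≤ 1)
    -- the defect operator `D_C` of `C`
    (DC : Hd d H_C →L[ℂ] Hd d H_C) (hDCpos : DC.IsPositive)
    (hDCsq : DC.comp DC = 1 - (adjoint (rowOp C)).comp (rowOp C))
    -- the defect operator `D_{*,C}` of `C`
    (DsC : H_C →L[ℂ] H_C) (hDsCpos : DsC.IsPositive)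
    (hDsCsq : DsC.comp DsC = 1 - (rowOp C).comp (adjoint (rowOp C)))
    -- the defect operator `D_{*,A}` of `A`
    (DsA : H_A →L[ℂ] H_A) (hDsApos : DsA.IsPositive)
    (hDsAsq : DsA.comp DsA = 1 - (rowOp A).comp (adjoint (rowOp A)))
    -- the contraction `δ : 𝒟_{*,A} → 𝒟_C`
    (δ : ↥(defectSpace DsA) →L[ℂ] ↥(defectSpace DC)) (hδ : ‖δ‖ ≤ 1)
    -- the defect operator `D_δ` of `δ`
    (Dδ : ↥(defectSpace DsA) →L[ℂ] ↥(defectSpace DsA)) (hDδpos : Dδ.IsPositive)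
    (hDδsq : Dδ.comp Dδ = 1 - (adjoint δ).comp δ)
    -- `B := D_{*,A} ∘ δ* ∘ D_C : H_C^d → H_A`
    (B : Hd d H_C →L[ℂ] H_A)
    (hB : B = DsA.comp (((defectSpace DsA).subtypeL).comp ((adjoint δ).comp (toDefect DC))))
    -- the lifting `E`, `E_i = [[C_i, 0], [B ∘ ι_i, A_i]]`
    (E : Fin d → (WithLp 2 (H_C × H_A) →L[ℂ] WithLp 2 (H_C × H_A)))
    (hE : ∀ i, E i = block2 (C i) 0 (B.comp (inclPi i)) (A i))
    -- the defect operator `D_{*,E}` of `E`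
    (DsE : WithLp 2 (H_C × H_A) →L[ℂ] WithLp 2 (H_C × H_A)) (hDsEpos : DsE.IsPositive)
    (hDsEsq : DsE.comp DsE = 1 - (rowOp E).comp (adjoint (rowOp E))) :
    ∃ σE : ↥(defectSpace DsE) ≃ₗᵢ[ℂ] WithLp 2 (↥(defectSpace DsC) × ↥(defectSpace Dδ)),
      ∀ (hc : H_C) (ha : H_A),
        ((((WithLp.equiv 2 _)
              (σE (toDefect DsE ((WithLp.equiv 2 (H_C × H_A)).symm (hc, ha))))).1 :
            ↥(defectSpace DsC)) : H_C) =
          DsC hc - (rowOp C) ((δ (toDefect DsA ha) : ↥(defectSpace DC)) : Hd d H_C) ∧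
        ((((WithLp.equiv 2 _)
              (σE (toDefect DsE ((WithLp.equiv 2 (H_C × H_A)).symm (hc, ha))))).2 :
            ↥(defectSpace Dδ)) : ↥(defectSpace DsA)) = Dδ (toDefect DsA ha) := by
  have hint : ∀ y, rowOp C (DC y) = DsC (rowOp C y) :=
    aux_intertwine (rowOp C) DC hDCpos hDCsq DsC hDsCpos hDsCsq
  have hmem := aux_mem (rowOp C) DC DsC hint
  let G : ↥(defectSpace DC) →L[ℂ] ↥(defectSpace DsC) :=
    ((rowOp C).comp (defectSpace DC).subtypeL).codRestrict _ hmem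
  let T : WithLp 2 (H_C × H_A) →L[ℂ] WithLp 2 (↥(defectSpace DsC) × ↥(defectSpace Dδ)) :=
    block2 (toDefect DsC) (-(G.comp (δ.comp (toDefect DsA)))) 0
      ((toDefect Dδ).comp (toDefect DsA))
  have T1 : ∀ v, (T v).fst = toDefect DsC v.fst - G (δ (toDefect DsA v.snd)) := fun v => by
    simp [T, block2_apply, sub_eq_add_neg]
  have T2 : ∀ v, (T v).snd = toDefect Dδ (toDefect DsA v.snd) := fun v => by
    simp [T, block2_apply]
  have hBadj : ∀ x, adjoint B x = DC (δ (toDefect DsA x) : ↥(defectSpace DC)) := by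
    intro x
    refine ext_inner_left ℂ fun v => ?_
    rw [adjoint_inner_right, hB]
    simp only [comp_apply]
    rw [hDsApos.inner_left_eq_inner_right, ← hDCpos.inner_left_eq_inner_right]
    change inner ℂ (adjoint δ (toDefect DC v)) (toDefect DsA x) =
      inner ℂ (toDefect DC v) (δ (toDefect DsA x))
    rw [adjoint_inner_left]
  have hnorm : ∀ v, ‖T v‖ = ‖toDefect DsE v‖ := by
    intro v
    rw [← sq_eq_sq₀ (norm_nonneg _) (norm_nonneg _)]
    have n1 : ‖toDefect DsE v‖ ^ 2 = ‖v‖ ^ 2 - ‖adjoint (rowOp E) v‖ ^ 2 :=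
      aux_defect_norm DsE hDsEpos (adjoint (rowOp E)) (by rw [adjoint_adjoint]; exact hDsEsq) v
    have n2 := aux_defect_norm DsA hDsApos (adjoint (rowOp A))
      (by rw [adjoint_adjoint]; exact hDsAsq) v.snd
    have n3 := aux_defect_norm DsC hDsCpos (adjoint (rowOp C))
      (by rw [adjoint_adjoint]; exact hDsCsq) v.fst
    have n4 := aux_defect_norm Dδ hDδpos δ hDδsq (toDefect DsA v.snd)
    have n5 := aux_defect_norm DC hDCpos (rowOp C) hDCsq
      (δ (toDefect DsA v.snd) : ↥(defectSpace DC))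
    rw [n1, aux_adjoint C A B E hE v, hBadj, WithLp.prod_norm_sq_eq_of_L2,
      WithLp.prod_norm_sq_eq_of_L2, T1, T2]
    have m1 : ‖toDefect DsC v.fst - G (δ (toDefect DsA v.snd))‖ =
      ‖DsC v.fst - rowOp C (δ (toDefect DsA v.snd) : ↥(defectSpace DC))‖ := rfl
    have m2 : ‖toDefect Dδ (toDefect DsA v.snd)‖ = ‖Dδ (toDefect DsA v.snd)‖ := rfl
    have m3 : ‖toDefect DsA v.snd‖ = ‖DsA v.snd‖ := rfl
    have m4 : ‖(δ (toDefect DsA v.snd))‖ =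
      ‖((δ (toDefect DsA v.snd) : ↥(defectSpace DC)) : Hd d H_C)‖ := rfl
    rw [m3, m4] at n4
    rw [m1, m2]
    generalize ((δ (toDefect DsA v.snd) : ↥(defectSpace DC)) : Hd d H_C) = y at *
    have c : inner ℂ (DsC v.fst) (rowOp C y) = inner ℂ (adjoint (rowOp C) v.fst) (DC y) := by
      rw [hDsCpos.inner_left_eq_inner_right, ← hint, adjoint_inner_left]
    rw [@norm_sub_sq ℂ, @norm_add_sq ℂ, c]
    linarith
  have hdense : DenseRange T := by
    refine aux_dense T fun w hw => ?_
    have hw' : ∀ v, inner ℂ w.fst (T v).fst + inner ℂ w.snd (T v).snd = 0 := fun v => by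
      rw [← hw v]
      exact (WithLp.prod_inner_apply _ _).symm
    have w1 : w.fst = 0 := by
      refine aux_orth DsC _ fun x => ?_
      have := hw' (WithLp.toLp 2 (x, 0))
      rw [T1, T2] at this
      simpa [toDefect_coe] using this
    have w2 : w.snd = 0 := by
      refine aux_orth Dδ _ fun x => ?_
      refine (toDefect_dense DsA).induction_on
        (p := fun x => inner ℂ (w.snd : ↥(defectSpace DsA)) (Dδ x) = 0) x ?_ ?_
      · exact isClosed_eq (by fun_prop) continuous_const
      · intro a
        have := hw' (WithLp.toLp 2 (0, a))
        rw [w1, T2] at this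
        simpa [toDefect_coe] using this
    exact WithLp.ofLp_injective 2 (Prod.ext w1 w2)
  obtain ⟨σ, hσ⟩ := aux_ext (toDefect DsE) T (toDefect_dense DsE) hdense hnorm
  refine ⟨σ, fun hc ha => ?_⟩
  rw [hσ]
  constructor
  · exact congrArg Subtype.val (T1 _)
  · exact congrArg Subtype.val (T2 _)
end
end

section
/- Let K_1, K_2, H_1, H_2 be Hilbert spaces and U : K_1 ⊕ K_2 → H_1 ⊕ H_2 a unitary operator. Write U* in block form U* = [[P, Q],[R, S]] with P : H_1 → K_1, Q : H_2 → K_1, R : H_1 → K_2 and S : H_2 → K_2 (so P = P_{K_1} U* ι_{H_1}, etc., where ι denotes coordinate inclusion and P_{K_i} the coordinate projection). Define the closed subspaces F' := K_1 ⊖ closure(P H_1) (the orthogonal complement of closure(range P) in K_1) and F'_* := H_2 ⊖ closure(S* K_2). Then U maps F' (viewed inside K_1 ⊕ K_2) onto F'_* (viewed inside H_1 ⊕ H_2); that is, U(F') = F'_*. -/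
noncomputable section

open ContinuousLinearMap in
/-- For a unitary `U : K₁ ⊕ K₂ → H₁ ⊕ H₂` with `U* = [[P, Q], [R, S]]`,
`U` maps `F' = K₁ ⊖ closure(P H₁)` onto `F'_* = H₂ ⊖ closure(S* K₂)`. -/
theorem statement8 {K₁ K₂ H₁ H₂ : Type*}
    [NormedAddCommGroup K₁] [InnerProductSpace ℂ K₁] [CompleteSpace K₁]
    [NormedAddCommGroup K₂] [InnerProductSpace ℂ K₂] [CompleteSpace K₂]
    [NormedAddCommGroup H₁] [InnerProductSpace ℂ H₁] [CompleteSpace H₁]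
    [NormedAddCommGroup H₂] [InnerProductSpace ℂ H₂] [CompleteSpace H₂]
    (U : WithLp 2 (K₁ × K₂) ≃ₗᵢ[ℂ] WithLp 2 (H₁ × H₂))
    (P : H₁ →L[ℂ] K₁) (Q : H₂ →L[ℂ] K₁) (R : H₁ →L[ℂ] K₂) (S : H₂ →L[ℂ] K₂)
    -- `P, Q, R, S` are the blocks of `U* = U⁻¹`
    (hblk : ∀ (h₁ : H₁) (h₂ : H₂),
      U.symm ((WithLp.equiv 2 (H₁ × H₂)).symm (h₁, h₂)) =
        (WithLp.equiv 2 (K₁ × K₂)).symm (P h₁ + Q h₂, R h₁ + S h₂)) :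
    (⇑U) '' ((fun x : K₁ => (WithLp.equiv 2 (K₁ × K₂)).symm (x, 0)) ''
        (((((LinearMap.range (P : H₁ →ₗ[ℂ] K₁)).topologicalClosure)ᗮ : Submodule ℂ K₁) : Set K₁))) =
      (fun y : H₂ => (WithLp.equiv 2 (H₁ × H₂)).symm (0, y)) ''
        (((((LinearMap.range (adjoint S : K₂ →ₗ[ℂ] H₂)).topologicalClosure)ᗮ : Submodule ℂ H₂) : Set H₂)) := by
  have hP : ∀ x : K₁, x ∈ ((LinearMap.range (P : H₁ →ₗ[ℂ] K₁)).topologicalClosure)ᗮ ↔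
      ∀ h, inner ℂ (P h) x = 0 := by
    intro x
    rw [Submodule.orthogonal_closure, Submodule.mem_orthogonal]
    constructor
    · intro H h
      exact H _ ⟨h, rfl⟩
    · rintro H _ ⟨h, rfl⟩
      exact H h
  have hS : ∀ y : H₂, y ∈ ((LinearMap.range (adjoint S : K₂ →ₗ[ℂ] H₂)).topologicalClosure)ᗮ ↔
      S y = 0 := by
    intro y
    rw [Submodule.orthogonal_closure, Submodule.mem_orthogonal]
    constructor
    · intro H
      have h1 : inner ℂ (adjoint S (S y)) y = 0 := H _ ⟨S y, rfl⟩
      rw [adjoint_inner_left] at h1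
      exact inner_self_eq_zero.mp h1
    · rintro H _ ⟨k, rfl⟩
      change inner ℂ (adjoint S k) y = 0
      rw [adjoint_inner_left, H, inner_zero_right]
  have key : ∀ (h : H₁) (x : K₁),
      inner ℂ (P h) x = inner ℂ h (U ((WithLp.equiv 2 (K₁ × K₂)).symm (x, 0))).fst := by
    intro h x
    have h1 := U.symm.inner_map_map ((WithLp.equiv 2 (H₁ × H₂)).symm (h, 0))
      (U ((WithLp.equiv 2 (K₁ × K₂)).symm (x, 0)))
    rw [hblk, U.symm_apply_apply] at h1
    simpa [WithLp.prod_inner_apply] using h1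
  ext z
  constructor
  · rintro ⟨_, ⟨x, hx, rfl⟩, rfl⟩
    have hx' := (hP x).1 hx
    set z := U ((WithLp.equiv 2 (K₁ × K₂)).symm (x, 0)) with hz
    have ha : z.fst = 0 := by
      have := hx' z.fst
      rw [key] at this
      exact inner_self_eq_zero.mp this
    have hzz : (WithLp.equiv 2 (H₁ × H₂)).symm (0, z.snd) = z := by
      rw [← ha]; rfl
    refine ⟨z.snd, (hS _).2 ?_, hzz⟩
    have h2 := hblk 0 z.snd
    rw [hzz, hz, U.symm_apply_apply, ← hz] at h2
    have h3 := congrArg WithLp.snd h2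
    simpa using h3.symm
  · rintro ⟨y, hy, rfl⟩
    have hy' := (hS y).1 hy
    have h2 := hblk 0 y
    simp only [map_zero, zero_add, hy'] at h2
    have h3 : U ((WithLp.equiv 2 (K₁ × K₂)).symm (Q y, 0)) =
        (WithLp.equiv 2 (H₁ × H₂)).symm (0, y) := by
      rw [← h2, U.apply_symm_apply]
    refine ⟨_, ⟨Q y, (hP _).2 ?_, rfl⟩, h3⟩
    intro h
    rw [key, h3]
    simp
end
end

section
/- Let R : H → K be a contraction between Hilbert spaces, with defect spaces 𝒟_R := closure(range D_R) ⊆ H and 𝒟_{*,R} := closure(range D_{*,R}) ⊆ K. Note that R(𝒟_R) ⊆ 𝒟_{*,R}. If Q_1 : 𝒟_R → 𝒟_{*,R} is a bounded operator satisfying R(D_R x) + D_{*,R}(Q_1 x) = 0 for all x ∈ 𝒟_R, then Q_1 = −R|_{𝒟_R}, i.e. Q_1 x = −R x for all x ∈ 𝒟_R. -/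
noncomputable section

open ContinuousLinearMap in
theorem sylv_zero {H K : Type*}
    [NormedAddCommGroup H] [InnerProductSpace ℂ H] [CompleteSpace H]
    [NormedAddCommGroup K] [InnerProductSpace ℂ K] [CompleteSpace K]
    (X : H →L[ℂ] K) (A : H →L[ℂ] H) (hA : A.IsPositive) (B : K →L[ℂ] K) (hB : B.IsPositive)
    (h : ∀ x, B (X x) = - X (A x)) : ∀ x, X (A x) = 0 := by
  have hAs : ∀ x y, inner ℂ (A x) y = inner ℂ x (A y) := fun x y => hA.isSymmetric x y
  have hBs : ∀ x y, inner ℂ (B x) y = inner ℂ x (B y) := fun x y => hB.isSymmetric x y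
  set C : H →L[ℂ] H := (adjoint X).comp X with hC
  have hCpos : C.IsPositive := isPositive_adjoint_comp_self X
  have hcomm : Commute C A := by
    show C * A = A * C
    ext x
    refine ext_inner_left ℂ fun y => ?_
    show inner ℂ y (C (A x)) = inner ℂ y (A (C x))
    rw [← hAs]
    simp only [hC, comp_apply, adjoint_inner_right]
    have h1 : X (A x) = - B (X x) := by rw [h, neg_neg]
    have h2 : X (A y) = - B (X y) := by rw [h, neg_neg]
    rw [h1, h2, inner_neg_right, inner_neg_left, hBs]
  have hpos : 0 ≤ C * A := hcomm.mul_nonneg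
    ((nonneg_iff_isPositive C).2 hCpos) ((nonneg_iff_isPositive A).2 hA)
  have hCA : C * A = -((adjoint X).comp (B.comp X)) := by
    ext x
    simp [hC, h]
  have hPpos : 0 ≤ (adjoint X).comp (B.comp X) :=
    (nonneg_iff_isPositive _).2 (hB.adjoint_conj X)
  have hz : C * A = 0 := le_antisymm (by rw [hCA]; exact neg_nonpos.2 hPpos) hpos
  intro x
  have h0 : C (A x) = 0 := by
    have := congrArg (fun T : H →L[ℂ] H => T x) hz
    simpa using this
  rw [← inner_self_eq_zero (𝕜 := ℂ), ← adjoint_inner_right]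
  have : adjoint X (X (A x)) = 0 := h0
  rw [this, inner_zero_right]

open ContinuousLinearMap in
theorem intertwine {H K : Type*}
    [NormedAddCommGroup H] [InnerProductSpace ℂ H] [CompleteSpace H]
    [NormedAddCommGroup K] [InnerProductSpace ℂ K] [CompleteSpace K]
    (R : H →L[ℂ] K) (A : H →L[ℂ] H) (hA : A.IsPositive) (B : K →L[ℂ] K) (hB : B.IsPositive)
    (h : ∀ x, R (A (A x)) = B (B (R x))) : ∀ x, R (A x) = B (R x) := by
  have hAs : ∀ x y, inner ℂ (A x) y = inner ℂ x (A y) := fun x y => hA.isSymmetric x y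
  have hBs : ∀ x y, inner ℂ (B x) y = inner ℂ x (B y) := fun x y => hB.isSymmetric x y
  set X : H →L[ℂ] K := R.comp A - B.comp R with hX
  have hXa : ∀ x, X x = R (A x) - B (R x) := fun x => by simp [hX]
  have hs : ∀ x, B (X x) = - X (A x) := fun x => by
    rw [hXa, hXa, h, map_sub]; abel
  have h1 := sylv_zero X A hA B hB hs
  have h2 : ∀ x, B (X x) = 0 := fun x => by rw [hs, h1, neg_zero]
  have h3 : ∀ y, A (adjoint X y) = 0 := fun y => by
    refine ext_inner_left ℂ fun z => ?_
    rw [← hAs, adjoint_inner_right, h1, inner_zero_left, inner_zero_right]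
  have h4 : ∀ y, X (adjoint X y) = 0 := fun y => by
    rw [← inner_self_eq_zero (𝕜 := ℂ)]
    nth_rewrite 2 [hXa]
    rw [h3, map_zero, zero_sub, inner_neg_right, ← hBs, h2, inner_zero_left, neg_zero]
  intro x
  have h5 : ∀ y, adjoint X y = 0 := fun y => by
    rw [← inner_self_eq_zero (𝕜 := ℂ), adjoint_inner_right, h4, inner_zero_left]
  have h6 : X x = 0 := by
    rw [← inner_self_eq_zero (𝕜 := ℂ), ← adjoint_inner_right, h5, inner_zero_right]
  rw [hXa] at h6
  exact sub_eq_zero.1 h6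

open ContinuousLinearMap in
/-- If `R : H → K` is a contraction, then `R(𝒟_R) ⊆ 𝒟_{*,R}`, and any bounded
`Q₁ : 𝒟_R → 𝒟_{*,R}` with `R D_R + D_{*,R} Q₁ = 0` on `𝒟_R` satisfies `Q₁ = −R|_{𝒟_R}`. -/
theorem statement10 {H K : Type*}
    [NormedAddCommGroup H] [InnerProductSpace ℂ H] [CompleteSpace H]
    [NormedAddCommGroup K] [InnerProductSpace ℂ K] [CompleteSpace K]
    (R : H →L[ℂ] K) (hR : ‖R‖ ≤ 1)
    -- the defect operator `D_R` of `R`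
    (DR : H →L[ℂ] H) (hDRpos : DR.IsPositive)
    (hDRsq : DR.comp DR = 1 - (adjoint R).comp R)
    -- the defect operator `D_{*,R}` of `R`
    (DsR : K →L[ℂ] K) (hDsRpos : DsR.IsPositive)
    (hDsRsq : DsR.comp DsR = 1 - R.comp (adjoint R))
    (Q₁ : ↥(defectSpace DR) →L[ℂ] ↥(defectSpace DsR))
    (hQ₁ : ∀ x : ↥(defectSpace DR), R (DR (↑x : H)) + DsR ((Q₁ x : ↥(defectSpace DsR)) : K) = 0) :
    (∀ x ∈ defectSpace DR, R x ∈ defectSpace DsR) ∧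
      ∀ x : ↥(defectSpace DR), ((Q₁ x : ↥(defectSpace DsR)) : K) = -(R (↑x : H)) := by
  have hAA : ∀ x, DR (DR x) = x - adjoint R (R x) := fun x => by
    simpa using congrArg (fun T : H →L[ℂ] H => T x) hDRsq
  have hBB : ∀ x, DsR (DsR x) = x - R (adjoint R x) := fun x => by
    simpa using congrArg (fun T : K →L[ℂ] K => T x) hDsRsq
  have hint := intertwine R DR hDRpos DsR hDsRpos (fun x => by rw [hAA, hBB, map_sub])
  have hmem : ∀ x ∈ defectSpace DR, R x ∈ defectSpace DsR := by
    intro x hx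
    refine map_mem_closure R.continuous hx ?_
    rintro _ ⟨y, rfl⟩
    exact ⟨R y, (hint y).symm⟩
  refine ⟨hmem, fun x => ?_⟩
  have hz : DsR ((Q₁ x : K) + R x) = 0 := by
    rw [map_add, ← hint, add_comm]; exact hQ₁ x
  have hzm : (Q₁ x : K) + R x ∈ defectSpace DsR :=
    add_mem (Q₁ x).2 (hmem x x.2)
  have horth : (Q₁ x : K) + R x ∈ (defectSpace DsR)ᗮ := by
    rw [Submodule.orthogonal_closure]
    rintro _ ⟨y, rfl⟩
    have : inner ℂ (DsR y) ((Q₁ x : K) + R x) = inner ℂ y (DsR ((Q₁ x : K) + R x)) :=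
      hDsRpos.isSymmetric _ _
    show inner ℂ (DsR y) ((Q₁ x : K) + R x) = 0
    rw [this, hz, inner_zero_right]
  have h0 : (Q₁ x : K) + R x = 0 := inner_self_eq_zero.1 (horth _ hzm)
  exact eq_neg_of_add_eq_zero_left h0
end
end

section
/- Let K_1, K_2, H_1, H_2 be Hilbert spaces and U : K_1 ⊕ K_2 → H_1 ⊕ H_2 a unitary operator with block decomposition of its adjoint U* = [[P, Q],[R, S]], where P : H_1 → K_1, Q : H_2 → K_1, R : H_1 → K_2, S : H_2 → K_2. Assume closure(range P) = K_1 and closure(range S*) = H_2. Then R is a contraction and there exist unitary operators U_1 : K_1 → 𝒟_R and U_2 : H_2 → 𝒟_{*,R} such that U_1(P x) = D_R x for all x ∈ H_1, U_2(S* y) = D_{*,R} y for all y ∈ K_2, and U = (I_{H_1} ⊕ U_2*) ∘ J ∘ (U_1 ⊕ I_{K_2}), where J : 𝒟_R ⊕ K_2 → H_1 ⊕ 𝒟_{*,R} is the unitary operator with block matrix J = [[D_R|_{𝒟_R}, R*],[−R|_{𝒟_R}, D_{*,R}]] (here D_R|_{𝒟_R} : 𝒟_R → H_1 via the inclusion 𝒟_R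 ⊆ H_1, R|_{𝒟_R} : 𝒟_R → 𝒟_{*,R}, and D_{*,R} is viewed as a map K_2 → 𝒟_{*,R}). -/
noncomputable section

open ContinuousLinearMap in
theorem aux_intertwine_s11 {H K : Type*}
    [NormedAddCommGroup H] [InnerProductSpace ℂ H] [CompleteSpace H]
    [NormedAddCommGroup K] [InnerProductSpace ℂ K] [CompleteSpace K]
    (R : H →L[ℂ] K) (T : H →L[ℂ] H) (hT : T.IsPositive) (V : K →L[ℂ] K) (hV : V.IsPositive)
    (hTT : T.comp T = 1 - (adjoint R).comp R) (hVV : V.comp V = 1 - R.comp (adjoint R)) (x : H) :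
    R (T x) = V (R x) := by
  have hTT' : ∀ x, T (T x) = x - adjoint R (R x) := fun x => by
    simpa using congrArg (fun f => f x) hTT
  have hVV' : ∀ x, V (V x) = x - R (adjoint R x) := fun x => by
    simpa using congrArg (fun f => f x) hVV
  have hTs : ∀ x y, inner ℂ (T x) y = inner ℂ x (T y) := fun x y => hT.isSymmetric x y
  have hVs : ∀ x y, inner ℂ (V x) y = inner ℂ x (V y) := fun x y => hV.isSymmetric x y
  set X : H →L[ℂ] K := R.comp T - V.comp R with hX
  have hXa : ∀ x, X x = R (T x) - V (R x) := fun x => rfl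
  have hVX : ∀ x, V (X x) = - X (T x) := fun x => by
    simp only [hXa, map_sub, hTT', hVV']; abel
  have hA : (0 : H →L[ℂ] H) ≤ (adjoint X).comp X := by
    rw [nonneg_iff_isPositive]; exact isPositive_adjoint_comp_self X
  have hT0 : (0 : H →L[ℂ] H) ≤ T := by rw [nonneg_iff_isPositive]; exact hT
  have hBp : ((adjoint X).comp (V.comp X)).IsPositive := hV.adjoint_conj X
  have hB0 := (nonneg_iff_isPositive _).2 hBp
  have hAT : (adjoint X).comp X * T = - ((adjoint X).comp (V.comp X)) := by
    ext x; simp [hVX]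
  have hcomm : Commute ((adjoint X).comp X) T := by
    have h1 : IsSelfAdjoint ((adjoint X).comp X * T) := by
      rw [hAT]; exact hBp.isSelfAdjoint.neg
    exact (IsSelfAdjoint.commute_iff hA.isSelfAdjoint hT0.isSelfAdjoint).2 h1
  have h2 : (adjoint X).comp X * T = 0 := by
    apply le_antisymm
    · rw [hAT]; exact neg_nonpos.2 hB0
    · exact hcomm.mul_nonneg hA hT0
  have hXT : ∀ x, X (T x) = 0 := fun x => by
    have h3 : adjoint X (X (T x)) = 0 := congrArg (fun f => f x) h2
    rw [← inner_self_eq_zero (𝕜 := ℂ), ← adjoint_inner_left, h3, inner_zero_left]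
  have hVX0 : ∀ x, V (X x) = 0 := fun x => by rw [hVX, hXT, neg_zero]
  have hTX : ∀ y, T (adjoint X y) = 0 := fun y => by
    refine ext_inner_right ℂ fun z => ?_
    rw [hTs, adjoint_inner_left, hXT]; simp
  have h4 : ∀ y, X (adjoint X y) = 0 := fun y => by
    rw [← inner_self_eq_zero (𝕜 := ℂ)]
    nth_rewrite 1 [hXa (adjoint X y)]
    rw [hTX, map_zero, zero_sub, inner_neg_left, hVs, hVX0]; simp
  have h5 : ∀ y, adjoint X y = 0 := fun y => by
    rw [← inner_self_eq_zero (𝕜 := ℂ), adjoint_inner_left, h4, inner_zero_right]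
  have h6 : X x = 0 := by
    rw [← inner_self_eq_zero (𝕜 := ℂ), ← adjoint_inner_left, h5, inner_zero_left]
  exact sub_eq_zero.1 (by rw [← hXa, h6])

theorem aux_unitary {X Y Z : Type*}
    [NormedAddCommGroup X] [InnerProductSpace ℂ X]
    [NormedAddCommGroup Y] [InnerProductSpace ℂ Y] [CompleteSpace Y]
    [NormedAddCommGroup Z] [InnerProductSpace ℂ Z] [CompleteSpace Z]
    (A : X →L[ℂ] Y) (D : X →L[ℂ] Z) (hA : DenseRange A) (h : ∀ x, ‖D x‖ = ‖A x‖) :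
    ∃ W : Y ≃ₗᵢ[ℂ] ↥(defectSpace D), ∀ x, W (A x) = toDefect D x := by
  have hD : DenseRange (toDefect D) := by
    intro z
    rw [closure_subtype]
    have hz : (z : Z) ∈ closure (Set.range D) := z.2
    convert hz using 2
    ext w
    constructor
    · rintro ⟨_, ⟨x, rfl⟩, rfl⟩; exact ⟨x, rfl⟩
    · rintro ⟨x, rfl⟩; exact ⟨_, ⟨x, rfl⟩, rfl⟩
  have : CompleteSpace ↥(defectSpace D) :=
    (Submodule.isClosed_topologicalClosure _).completeSpace_coe
  exact ⟨(LinearEquiv.refl ℂ X).extendOfIsometry (A : X →ₗ[ℂ] Y)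
    (toDefect D : X →ₗ[ℂ] ↥(defectSpace D)) hA hD h,
    fun x => LinearEquiv.extendOfIsometry_eq (LinearEquiv.refl ℂ X) _ _ hA hD h x⟩

open ContinuousLinearMap in
/-- For a unitary `U : K₁ ⊕ K₂ → H₁ ⊕ H₂` with `U* = [[P, Q], [R, S]]` such
that `P` has dense range in `K₁` and `S*` has dense range in `H₂`, `R` is a contraction and
there are unitaries `U₁ : K₁ → 𝒟_R`, `U₂ : H₂ → 𝒟_{*,R}` with `U₁(P x) = D_R x`,
`U₂(S* y) = D_{*,R} y`, and `U = (I ⊕ U₂*) ∘ J ∘ (U₁ ⊕ I)` where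
`J = [[D_R|_{𝒟_R}, R*], [−R|_{𝒟_R}, D_{*,R}]]`. -/
theorem statement11 {K₁ K₂ H₁ H₂ : Type*}
    [NormedAddCommGroup K₁] [InnerProductSpace ℂ K₁] [CompleteSpace K₁]
    [NormedAddCommGroup K₂] [InnerProductSpace ℂ K₂] [CompleteSpace K₂]
    [NormedAddCommGroup H₁] [InnerProductSpace ℂ H₁] [CompleteSpace H₁]
    [NormedAddCommGroup H₂] [InnerProductSpace ℂ H₂] [CompleteSpace H₂]
    (U : WithLp 2 (K₁ × K₂) ≃ₗᵢ[ℂ] WithLp 2 (H₁ × H₂))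
    (P : H₁ →L[ℂ] K₁) (Q : H₂ →L[ℂ] K₁) (R : H₁ →L[ℂ] K₂) (S : H₂ →L[ℂ] K₂)
    -- `P, Q, R, S` are the blocks of `U* = U⁻¹`
    (hblk : ∀ (h₁ : H₁) (h₂ : H₂),
      U.symm ((WithLp.equiv 2 (H₁ × H₂)).symm (h₁, h₂)) =
        (WithLp.equiv 2 (K₁ × K₂)).symm (P h₁ + Q h₂, R h₁ + S h₂))
    -- dense range assumptions
    (hP : (LinearMap.range (P : H₁ →ₗ[ℂ] K₁)).topologicalClosure = ⊤)
    (hS : (LinearMap.range (adjoint S : K₂ →ₗ[ℂ] H₂)).topologicalClosure = ⊤)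
    -- the defect operator `D_R` of `R`
    (DR : H₁ →L[ℂ] H₁) (hDRpos : DR.IsPositive)
    (hDRsq : DR.comp DR = 1 - (adjoint R).comp R)
    -- the defect operator `D_{*,R}` of `R`
    (DsR : K₂ →L[ℂ] K₂) (hDsRpos : DsR.IsPositive)
    (hDsRsq : DsR.comp DsR = 1 - R.comp (adjoint R)) :
    ‖R‖ ≤ 1 ∧
      ∃ (U₁ : K₁ ≃ₗᵢ[ℂ] ↥(defectSpace DR)) (U₂ : H₂ ≃ₗᵢ[ℂ] ↥(defectSpace DsR)),
        (∀ x : H₁, U₁ (P x) = toDefect DR x) ∧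
        (∀ y : K₂, U₂ ((adjoint S) y) = toDefect DsR y) ∧
        -- the factorization `U = (I ⊕ U₂*) ∘ J ∘ (U₁ ⊕ I)`, stated entrywise:
        -- the first component of `U(k₁ ⊕ k₂)` is `D_R (U₁ k₁) + R* k₂` and `U₂` maps its
        -- second component to `−R (U₁ k₁) + D_{*,R} k₂`
        ∀ (k₁ : K₁) (k₂ : K₂),
          (((WithLp.equiv 2 (H₁ × H₂)) (U ((WithLp.equiv 2 (K₁ × K₂)).symm (k₁, k₂)))).1 =
              DR ((U₁ k₁ : ↥(defectSpace DR)) : H₁) + (adjoint R) k₂) ∧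
          ((U₂ (((WithLp.equiv 2 (H₁ × H₂)) (U ((WithLp.equiv 2 (K₁ × K₂)).symm (k₁, k₂)))).2) :
              ↥(defectSpace DsR)) : K₂) =
            -(R ((U₁ k₁ : ↥(defectSpace DR)) : H₁)) + DsR k₂ := by
  have hdP : DenseRange P := by
    intro z
    have : z ∈ (LinearMap.range (P : H₁ →ₗ[ℂ] K₁)).topologicalClosure := by rw [hP]; trivial
    exact this
  have hdS : DenseRange (adjoint S) := by
    intro z
    have : z ∈ (LinearMap.range (adjoint S : K₂ →ₗ[ℂ] H₂)).topologicalClosure := by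
      rw [hS]; trivial
    exact this
  have hblk' : ∀ h₁ h₂, U.symm (WithLp.toLp 2 (h₁, h₂)) =
      WithLp.toLp 2 (P h₁ + Q h₂, R h₁ + S h₂) := hblk
  -- entries of `U`
  have hU : ∀ k₁ k₂, U (WithLp.toLp 2 (k₁, k₂)) =
      WithLp.toLp 2 (adjoint P k₁ + adjoint R k₂, adjoint Q k₁ + adjoint S k₂) := by
    intro k₁ k₂
    refine ext_inner_right ℂ fun z => ?_
    obtain ⟨⟨a, b⟩, rfl⟩ := (WithLp.equiv 2 (H₁ × H₂)).symm.surjective z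
    rw [← U.symm.inner_map_map, U.symm_apply_apply, hblk]
    simp only [WithLp.prod_inner_apply, WithLp.equiv_symm_apply, inner_add_left, inner_add_right,
      adjoint_inner_left]
    ring
  have hinv1 : ∀ x, adjoint P (P x) + adjoint R (R x) = x ∧
      adjoint Q (P x) + adjoint S (R x) = 0 := by
    intro x
    have h := U.apply_symm_apply (WithLp.toLp 2 (x, 0))
    rw [hblk', hU] at h
    have h' := congrArg WithLp.ofLp h
    simpa using h'
  have hinv2 : ∀ y, R (adjoint R y) + S (adjoint S y) = y := by
    intro y
    have h := U.symm_apply_apply (WithLp.toLp 2 (0, y))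
    rw [hU, hblk'] at h
    have h' := congrArg (fun z => (WithLp.ofLp z).2) h
    simpa using h'
  have hDD : ∀ x, DR (DR x) = adjoint P (P x) := fun x => by
    have h1 : DR (DR x) = x - adjoint R (R x) := by simpa using congrArg (fun f => f x) hDRsq
    rw [h1, sub_eq_iff_eq_add, (hinv1 x).1]
  have hDDs : ∀ y, DsR (DsR y) = S (adjoint S y) := fun y => by
    have h1 : DsR (DsR y) = y - R (adjoint R y) := by
      simpa using congrArg (fun f => f y) hDsRsq
    rw [h1, sub_eq_iff_eq_add', hinv2]
  have hn1 : ∀ x, ‖DR x‖ = ‖P x‖ := fun x => by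
    have h : inner ℂ (DR x) (DR x) = inner ℂ (P x) (P x) := by
      rw [← adjoint_inner_left P, ← hDD]; exact (hDRpos.isSymmetric (DR x) x).symm
    rw [@norm_eq_sqrt_re_inner ℂ, @norm_eq_sqrt_re_inner ℂ _ _ _ _ (P x), h]
  have hn2 : ∀ y, ‖DsR y‖ = ‖adjoint S y‖ := fun y => by
    have h : inner ℂ (DsR y) (DsR y) = inner ℂ (adjoint S y) (adjoint S y) := by
      rw [adjoint_inner_right S, ← hDDs]; exact (hDsRpos.isSymmetric (DsR y) y).symm
    rw [@norm_eq_sqrt_re_inner ℂ, @norm_eq_sqrt_re_inner ℂ _ _ _ _ (adjoint S y), h]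
  refine ⟨?_, ?_⟩
  · refine opNorm_le_bound _ zero_le_one fun x => ?_
    have h := U.symm.norm_map (WithLp.toLp 2 (x, 0))
    rw [hblk'] at h
    have h2 := congrArg (· ^ 2) h
    simp only [WithLp.prod_norm_sq_eq_of_L2] at h2
    simp at h2
    rw [one_mul]
    exact le_of_sq_le_sq (by nlinarith [sq_nonneg ‖P x‖]) (norm_nonneg _)
  obtain ⟨U₁, hU₁⟩ := aux_unitary P DR hdP hn1
  obtain ⟨U₂, hU₂⟩ := aux_unitary (adjoint S) DsR hdS hn2
  refine ⟨U₁, U₂, hU₁, hU₂, fun k₁ k₂ => ?_⟩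
  have hc1 : Continuous fun k : K₁ => ((U₁ k : ↥(defectSpace DR)) : H₁) :=
    continuous_subtype_val.comp U₁.continuous
  have e1 : ∀ k, adjoint P k = DR ((U₁ k : ↥(defectSpace DR)) : H₁) := by
    intro k
    refine congrFun (hdP.equalizer (adjoint P).continuous (DR.continuous.comp hc1) ?_) k
    funext x
    simp only [Function.comp, hU₁]
    exact (hDD x).symm
  have e2 : ∀ k, ((U₂ (adjoint Q k) : ↥(defectSpace DsR)) : K₂) =
      -(R ((U₁ k : ↥(defectSpace DR)) : H₁)) := by
    intro k
    refine congrFun (hdP.equalizer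
      (continuous_subtype_val.comp (U₂.continuous.comp (adjoint Q).continuous))
      (h := fun k => -(R ((U₁ k : ↥(defectSpace DR)) : H₁))) ((R.continuous.comp hc1).neg) ?_) k
    funext x
    simp only [Function.comp, hU₁]
    rw [eq_neg_of_add_eq_zero_left (hinv1 x).2, map_neg, hU₂]
    change -(DsR (R x)) = -(R (DR x))
    rw [aux_intertwine_s11 R DR hDRpos DsR hDsRpos hDRsq hDsRsq]
  have h := hU k₁ k₂
  simp only [WithLp.equiv_symm_apply, WithLp.equiv_apply]
  rw [h]
  refine ⟨by rw [← e1], ?_⟩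
  change ((U₂ (adjoint Q k₁ + adjoint S k₂) : ↥(defectSpace DsR)) : K₂) = _
  rw [map_add, hU₂, Submodule.coe_add, e2]
  rfl
end
end
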